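/- Let K be a compact metric space, g : K → K a continuous map, E a nontrivial normed real vector space, A : K → (E →L E) a continuous map into the continuous linear endomorphisms of E with the operator norm, and P : K → (E →L E) a continuous map such that each P(x) is idempotent (P(x) ∘ P(x) = P(x)) and the equivariance P(g(x)) ∘ A(x) = A(x) ∘ P(x) holds for all x ∈ K (so the subbundle E(x) := range P(x) is A-invariant). Write A_n(x) := A(g^{n-1}(x)) ∘ ⋯ ∘ A(x). Suppose there exists λ < 0 such that ∫ log ‖A(x) ∘ P(x)‖ dμ(x) < λ for every g-invariant Borel probability measure μ on K. Then there exists N ∈ ℕ such that for all n ≥ N and all x ∈ K, ‖A_n(x) ∘ P(x)‖ ≤ e^{λ n}; in particular ‖A_n(x) v‖ ≤ e^{λ n} · ‖v‖ for every v in the range of P(x). -/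

import Mathlib

open MeasureTheory Filter

/-- The cocycle `A_n(x) = A(g^{n-1}(x)) ∘ ⋯ ∘ A(g(x)) ∘ A(x)` of continuous linear maps over
the map `g`. -/
noncomputable def mapCocycle {K E : Type*} [NormedAddCommGroup E] [NormedSpace ℝ E]
    (g : K → K) (A : K → (E →L[ℝ] E)) : ℕ → K → (E →L[ℝ] E)
  | 0, _ => ContinuousLinearMap.id ℝ E
  | n + 1, x => (A (g^[n] x)).comp (mapCocycle g A n x)

open scoped Topology BoundedContinuousFunction

/-- The empirical measure of a nonempty orbit segment integrates functions to their Birkhoff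
averages. -/
theorem exists_probabilityMeasure_integral_eq_birkhoffAverage
    {K : Type*} [TopologicalSpace K] [MeasurableSpace K] [OpensMeasurableSpace K]
    (g : K → K) (x : K) {n : ℕ} (hn : n ≠ 0) :
    ∃ μ : ProbabilityMeasure K, ∀ f : K →ᵇ ℝ,
      ∫ y, f y ∂(μ : Measure K) = birkhoffAverage ℝ g f n x := by
  let ν : Measure K := (n : ENNReal)⁻¹ • ∑ i ∈ Finset.range n, Measure.dirac (g^[i] x)
  have hν : IsProbabilityMeasure ν := by
    refine ⟨?_⟩
    simp only [ν, Measure.smul_apply, Measure.finsetSum_apply, measure_univ, Finset.sum_const,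
      Finset.card_range, smul_eq_mul, nsmul_eq_mul, mul_one]
    exact ENNReal.inv_mul_cancel (by exact_mod_cast hn) (ENNReal.natCast_ne_top n)
  refine ⟨⟨ν, hν⟩, fun f ↦ ?_⟩
  change ∫ y, f y ∂ν = _
  rw [integral_smul_measure, integral_finsetSum_measure (fun i _ ↦ f.integrable _)]
  simp [birkhoffAverage, birkhoffSum,
    integral_dirac' _ _ f.continuous.measurable.stronglyMeasurable]

/-- **Krylov–Bogolyubov**: Birkhoff averages over orbit segments of lengths tending to infinity
converge, along some finer ultrafilter, to the integrals against an invariant probability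
measure. -/
theorem exists_invariant_tendsto_birkhoffAverage
    {K : Type*} [MetricSpace K] [CompactSpace K] [MeasurableSpace K] [BorelSpace K]
    {g : K → K} (hg : Continuous g) {ι : Type*} {l : Filter ι} [l.NeBot]
    (n : ι → ℕ) (hn : Tendsto n l atTop) (x : ι → K) :
    ∃ μ : Measure K, IsProbabilityMeasure μ ∧ μ.map g = μ ∧
      ∃ U : Ultrafilter ι, ↑U ≤ l ∧ ∀ f : K →ᵇ ℝ,
        Tendsto (fun k ↦ birkhoffAverage ℝ g f (n k) (x k)) U (𝓝 (∫ y, f y ∂μ)) := by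
  have hex : ∀ k, ∃ μ : ProbabilityMeasure K, n k ≠ 0 → ∀ f : K →ᵇ ℝ,
      ∫ y, f y ∂(μ : Measure K) = birkhoffAverage ℝ g f (n k) (x k) := fun k ↦ by
    by_cases hk : n k = 0
    · exact ⟨⟨Measure.dirac (x k), inferInstance⟩, fun h ↦ absurd hk h⟩
    · obtain ⟨μ, hμ⟩ := exists_probabilityMeasure_integral_eq_birkhoffAverage g (x k) hk
      exact ⟨μ, fun _ ↦ hμ⟩
  choose m hm using hex
  set U : Ultrafilter ι := Ultrafilter.of l
  have hUl : ↑U ≤ l := Ultrafilter.of_le l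
  obtain ⟨μ, -, hμ⟩ := isCompact_univ.ultrafilter_le_nhds (U.map m) (by simp)
  have hlim : ∀ f : K →ᵇ ℝ, Tendsto (fun k ↦ birkhoffAverage ℝ g f (n k) (x k)) U
      (𝓝 (∫ y, f y ∂(μ : Measure K))) := fun f ↦ by
    refine (ProbabilityMeasure.tendsto_iff_forall_integral_tendsto.1 hμ f).congr' ?_
    filter_upwards [hUl (hn.eventually_ne_atTop 0)] with k hk using hm k hk f
  refine ⟨μ, inferInstance, ?_, U, hUl, hlim⟩
  have : IsProbabilityMeasure ((μ : Measure K).map g) :=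
    Measure.isProbabilityMeasure_map hg.measurable.aemeasurable
  refine ext_of_forall_integral_eq_of_IsFiniteMeasure fun f ↦ ?_
  rw [integral_map hg.measurable.aemeasurable
    f.continuous.measurable.aestronglyMeasurable]
  have hdiff := (hlim (f.compContinuous ⟨g, hg⟩)).sub (hlim f)
  refine sub_eq_zero.1 (tendsto_nhds_unique hdiff ?_)
  have hzero : Tendsto (fun k ↦ 2 * ‖f‖ / (n k : ℝ)) U (𝓝 0) :=
    tendsto_const_nhds.div_atTop (tendsto_natCast_atTop_atTop.comp (hn.mono_left hUl))
  refine squeeze_zero_norm (fun k ↦ ?_) hzero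
  have hcomp : birkhoffAverage ℝ g (f.compContinuous ⟨g, hg⟩) (n k) (x k) =
      birkhoffAverage ℝ g f (n k) (g (x k)) := by
    simp only [birkhoffAverage, birkhoffSum, BoundedContinuousFunction.compContinuous_apply,
      ContinuousMap.coe_mk, ← Function.iterate_succ_apply, Function.iterate_succ_apply']
  rw [hcomp, ← dist_eq_norm, dist_birkhoffAverage_apply_birkhoffAverage]
  gcongr
  exact f.dist_le_two_norm _ _

/-- The integrals of the truncations of `f` from below at `-M` converge to that of `f`. -/
theorem MeasureTheory.Integrable.tendsto_integral_max_neg_natCast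
    {α : Type*} [MeasurableSpace α] {μ : Measure α} {f : α → ℝ} (hf : Integrable f μ) :
    Tendsto (fun M : ℕ ↦ ∫ x, max (f x) (-(M : ℝ)) ∂μ) atTop (𝓝 (∫ x, f x ∂μ)) := by
  refine tendsto_integral_of_dominated_convergence (fun x ↦ |f x|)
    (fun M ↦ hf.aestronglyMeasurable.sup aestronglyMeasurable_const) hf.abs
    (fun M ↦ ae_of_all _ fun x ↦ ?_) (ae_of_all _ fun x ↦ ?_)
  · rw [Real.norm_eq_abs, abs_le]
    have hM : (0 : ℝ) ≤ M := M.cast_nonneg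
    refine ⟨(neg_abs_le _).trans (le_max_left _ _), max_le (le_abs_self _) ?_⟩
    linarith [abs_nonneg (f x)]
  · refine tendsto_const_nhds.congr' ?_
    filter_upwards [eventually_ge_atTop ⌈-f x⌉₊] with M hM
    exact (max_eq_left (by linarith [Nat.ceil_le.1 hM])).symm

/-- On an equivariant family of idempotents the cocycle is controlled by the product of the norms
of the restricted generators. -/
theorem norm_mapCocycle_comp_le_prod {K E : Type*} [NormedAddCommGroup E] [NormedSpace ℝ E]
    {g : K → K} {A P : K → (E →L[ℝ] E)} (hidem : ∀ x : K, (P x).comp (P x) = P x)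
    (hequiv : ∀ x : K, (P (g x)).comp (A x) = (A x).comp (P x)) {n : ℕ} (hn : n ≠ 0) (x : K) :
    ‖(mapCocycle g A n x).comp (P x)‖ ≤
      ∏ i ∈ Finset.range n, ‖(A (g^[i] x)).comp (P (g^[i] x))‖ := by
  have hcomm : ∀ k, (P (g^[k] x)).comp (mapCocycle g A k x) = (mapCocycle g A k x).comp (P x) := by
    intro k
    induction k with
    | zero => rfl
    | succ k ih =>
      rw [mapCocycle, Function.iterate_succ_apply', ← ContinuousLinearMap.comp_assoc, hequiv,
        ContinuousLinearMap.comp_assoc, ih, ContinuousLinearMap.comp_assoc]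
  obtain ⟨n, rfl⟩ := Nat.exists_eq_succ_of_ne_zero hn
  clear hn
  induction n with
  | zero => simp [mapCocycle]
  | succ n ih =>
    have hstep : (mapCocycle g A (n + 1 + 1) x).comp (P x) =
        ((A (g^[n + 1] x)).comp (P (g^[n + 1] x))).comp ((mapCocycle g A (n + 1) x).comp (P x)) := by
      rw [ContinuousLinearMap.comp_assoc, ← ContinuousLinearMap.comp_assoc (P _), hcomm,
        ContinuousLinearMap.comp_assoc _ (P x), hidem]
      rfl
    rw [Nat.succ_eq_add_one, Finset.prod_range_succ, hstep, mul_comm]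
    exact (ContinuousLinearMap.opNorm_comp_le _ _).trans
      (mul_le_mul_of_nonneg_left ih (norm_nonneg _))

/-- If the integral of `log b` against every invariant
probability measure is less than `c < 0`, then the products of `b` along orbit segments of
large length `n` are at most `e^{c n}`, uniformly in the starting point. -/
theorem eventually_prod_iterate_le_exp_of_integral_log_lt
    {K : Type*} [MetricSpace K] [CompactSpace K] [MeasurableSpace K] [BorelSpace K]
    {g : K → K} (hg : Continuous g) {b : K → ℝ} (hb : Continuous b) (hb0 : ∀ x, 0 ≤ b x)
    {c : ℝ} (hc : c < 0)
    (h : ∀ μ : Measure K, IsProbabilityMeasure μ → μ.map g = μ → ∫ x, Real.log (b x) ∂μ < c) :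
    ∀ᶠ n : ℕ in atTop, ∀ x, ∏ i ∈ Finset.range n, b (g^[i] x) ≤ Real.exp (c * n) := by
  by_contra hcon
  obtain ⟨φ, hφ, hbig⟩ := extraction_of_frequently_atTop (not_eventually.1 hcon)
  push Not at hbig
  choose x hx using hbig
  obtain ⟨μ, hμ, hinv, U, hU, hlim⟩ :=
    exists_invariant_tendsto_birkhoffAverage hg φ hφ.tendsto_atTop x
  have hlt := h μ hμ hinv
  have hint : Integrable (fun x ↦ Real.log (b x)) μ := by
    by_contra hni
    rw [integral_undef hni] at hlt
    exact hlt.not_gt hc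
  refine hlt.not_ge (ge_of_tendsto' hint.tendsto_integral_max_neg_natCast fun M ↦ ?_)
  have hpos : ∀ y, 0 < max (b y) (Real.exp (-(M : ℝ))) := fun y ↦
    lt_max_of_lt_right (Real.exp_pos _)
  let f : K →ᵇ ℝ := BoundedContinuousFunction.mkOfCompact
    ⟨fun y ↦ Real.log (max (b y) (Real.exp (-(M : ℝ)))),
      (hb.max continuous_const).log fun y ↦ (hpos y).ne'⟩
  have hfle : ∀ y, f y ≤ max (Real.log (b y)) (-(M : ℝ)) := fun y ↦ by
    change Real.log (max (b y) (Real.exp (-(M : ℝ)))) ≤ _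
    rcases le_total (b y) (Real.exp (-(M : ℝ))) with hy | hy
    · rw [max_eq_right hy, Real.log_exp]
      exact le_max_right _ _
    · rw [max_eq_left hy]
      exact le_max_left _ _
  have hfge : c ≤ ∫ y, f y ∂μ := by
    refine ge_of_tendsto (hlim f) ?_
    filter_upwards [hU ((hφ.tendsto_atTop).eventually_gt_atTop 0)] with k hk
    have hprod : Real.exp (c * φ k) ≤
        ∏ i ∈ Finset.range (φ k), max (b (g^[i] (x k))) (Real.exp (-(M : ℝ))) :=
      (hx k).le.trans (Finset.prod_le_prod (fun i _ ↦ hb0 _) fun i _ ↦ le_max_left _ _)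
    have hsum : c * φ k ≤ birkhoffSum g f (φ k) (x k) := by
      rw [← Real.log_exp (c * φ k)]
      refine (Real.log_le_log (Real.exp_pos _) hprod).trans_eq ?_
      exact Real.log_prod fun i _ ↦ (hpos _).ne'
    have hk' : (0 : ℝ) < φ k := by exact_mod_cast hk
    rw [birkhoffAverage, smul_eq_mul, inv_mul_eq_div, le_div_iff₀ hk']
    exact hsum
  exact hfge.trans (integral_mono (f.integrable μ)
    (hint.sup (integrable_const _)) hfle)

/-- Let `P(x)` be a continuous family of idempotents, equivariant under the cocycle `A` over
`g` (so the subbundle `range P(x)` is invariant).  If `∫ log ‖A(x) ∘ P(x)‖ dμ < λ < 0` for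
every `g`-invariant Borel probability measure `μ`, then eventually, uniformly on `K`,
`‖A_n(x) ∘ P(x)‖ ≤ e^{λ n}`; in particular `‖A_n(x) v‖ ≤ e^{λ n} ‖v‖` on `range P(x)`. -/
theorem subbundle_uniform_contraction_of_integral_lt
    {K : Type*} [MetricSpace K] [CompactSpace K] [MeasurableSpace K] [BorelSpace K]
    {E : Type*} [NormedAddCommGroup E] [NormedSpace ℝ E] [Nontrivial E]
    (g : K → K) (hg : Continuous g)
    (A : K → (E →L[ℝ] E)) (hA : Continuous A)
    (P : K → (E →L[ℝ] E)) (hP : Continuous P)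
    (hidem : ∀ x : K, (P x).comp (P x) = P x)
    (hequiv : ∀ x : K, (P (g x)).comp (A x) = (A x).comp (P x))
    (lam : ℝ) (hlam : lam < 0)
    (h : ∀ μ : Measure K, IsProbabilityMeasure μ → μ.map g = μ →
      (∫ x, Real.log ‖(A x).comp (P x)‖ ∂μ) < lam) :
    ∃ N : ℕ, ∀ n ≥ N, ∀ x : K,
      ‖(mapCocycle g A n x).comp (P x)‖ ≤ Real.exp (lam * n) ∧
      ∀ v ∈ LinearMap.range (P x : E →ₗ[ℝ] E), ‖mapCocycle g A n x v‖ ≤ Real.exp (lam * n) * ‖v‖ := by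
  obtain ⟨N, hN⟩ := eventually_atTop.1 <| eventually_prod_iterate_le_exp_of_integral_log_lt hg
    (b := fun x ↦ ‖(A x).comp (P x)‖) (hA.clm_comp hP).norm (fun x ↦ norm_nonneg _) hlam h
  refine ⟨N + 1, fun n hn x ↦ ?_⟩
  have hle : ‖(mapCocycle g A n x).comp (P x)‖ ≤ Real.exp (lam * n) :=
    (norm_mapCocycle_comp_le_prod hidem hequiv (by omega) x).trans (hN n (by omega) x)
  refine ⟨hle, ?_⟩
  rintro v ⟨w, rfl⟩
  have hfix : P x (P x w) = P x w := DFunLike.congr_fun (hidem x) w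
  have hv : mapCocycle g A n x (P x w) = (mapCocycle g A n x).comp (P x) (P x w) := by
    rw [ContinuousLinearMap.comp_apply, hfix]
  change ‖mapCocycle g A n x (P x w)‖ ≤ _ * ‖P x w‖
  rw [hv]
  exact ContinuousLinearMap.le_of_opNorm_le _ hle _
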